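/- arXiv:2402.08097 — 3 statements merged into one kernel-verified Lean document; each statement's English description precedes it below -/
import Mathlib

section
/- Under the AGM-BiO iteration with step sizes a_k = γ(k+1)/(4 L_f) for some 0 < γ ≤ 1, for any λ ≥ L_g / ((2/γ − 1) L_f) and any k ≥ 1, the weighted sum of errors satisfies λ(f(x_k) − f(x*)) + g(x_k) − g(x*) ≤ 4 L_g ‖x_0 − x*‖² (ln k + 1) / (k(k+1)) + 4 λ L_f ‖x_0 − x*‖² / (γ k(k+1)). -/
open RealInnerProductSpace

section

variable {E : Type*} [NormedAddCommGroup E] [InnerProductSpace ℝ E] [CompleteSpace E]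

theorem HasGradientAt.hasDerivAt_line {φ : E → ℝ} {φ' : E → E}
    (hφ : ∀ w, HasGradientAt φ (φ' w) w) (u d : E) (t : ℝ) :
    HasDerivAt (fun s : ℝ => φ (u + s • d)) ⟪φ' (u + t • d), d⟫ t := by
  have hline : HasDerivAt (fun s : ℝ => u + s • d) d t := by
    simpa using ((hasDerivAt_id t).smul_const d).const_add u
  exact ((hφ (u + t • d)).hasFDerivAt.comp_hasDerivAt t hline).congr_deriv
    InnerProductSpace.toDual_apply_apply

theorem ConvexOn.add_inner_gradient_le {φ : E → ℝ} {φ' : E → E}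
    (hconv : ConvexOn ℝ Set.univ φ) (hφ : ∀ w, HasGradientAt φ (φ' w) w) (u v : E) :
    φ u + ⟪φ' u, v - u⟫ ≤ φ v := by
  have hline : ConvexOn ℝ Set.univ (fun s : ℝ => φ (u + s • (v - u))) := by
    have := hconv.comp_affineMap (AffineMap.lineMap u v : ℝ →ᵃ[ℝ] E)
    simpa [Function.comp_def, AffineMap.lineMap_apply, add_comm] using this
  have hd := HasGradientAt.hasDerivAt_line hφ u (v - u) 0
  have := hline.le_slope_of_hasDerivAt (Set.mem_univ 0) (Set.mem_univ 1) one_pos hd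
  simp [slope_def_field] at this
  linarith

theorem le_add_inner_gradient_add_sq {φ : E → ℝ} {φ' : E → E} {L : ℝ}
    (hφ : ∀ w, HasGradientAt φ (φ' w) w) (hLip : ∀ u v, ‖φ' u - φ' v‖ ≤ L * ‖u - v‖) (u v : E) :
    φ v ≤ φ u + ⟪φ' u, v - u⟫ + L / 2 * ‖v - u‖ ^ 2 := by
  set d := v - u with hd
  let h : ℝ → ℝ := fun t => φ (u + t • d) - t * ⟪φ' u, d⟫ - L / 2 * ‖d‖ ^ 2 * t ^ 2
  have hder (t : ℝ) :
      HasDerivAt h (⟪φ' (u + t • d), d⟫ - ⟪φ' u, d⟫ - L / 2 * ‖d‖ ^ 2 * (2 * t)) t := by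
    have h1 := HasGradientAt.hasDerivAt_line hφ u d t
    have h2 := (hasDerivAt_id t).mul_const ⟪φ' u, d⟫
    have h3 := (hasDerivAt_pow 2 t).const_mul (L / 2 * ‖d‖ ^ 2)
    exact ((h1.sub h2).sub h3).congr_deriv (by simp)
  have hanti : AntitoneOn h (Set.Icc 0 1) := by
    refine antitoneOn_of_deriv_nonpos (convex_Icc 0 1)
      (fun t _ => (hder t).continuousAt.continuousWithinAt)
      (fun t _ => (hder t).differentiableAt.differentiableWithinAt) fun t ht => ?_
    rw [interior_Icc] at ht
    rw [(hder t).deriv, ← inner_sub_left]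
    have h1 := real_inner_le_norm (φ' (u + t • d) - φ' u) d
    have h2 := hLip (u + t • d) u
    rw [add_sub_cancel_left, norm_smul, Real.norm_of_nonneg ht.1.le] at h2
    nlinarith [mul_le_mul_of_nonneg_right h2 (norm_nonneg d)]
  have := hanti (Set.left_mem_Icc.2 zero_le_one) (Set.right_mem_Icc.2 zero_le_one) zero_le_one
  simp only [h, hd] at this
  simp at this
  linarith

/-- One accelerated step: upper bound through the linear model at the extrapolated point. -/
theorem ConvexOn.accelerated_step_le {φ : E → ℝ} {φ' : E → E} {L A a : ℝ}
    (hconv : ConvexOn ℝ Set.univ φ) (hφ : ∀ w, HasGradientAt φ (φ' w) w)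
    (hLip : ∀ u v, ‖φ' u - φ' v‖ ≤ L * ‖u - v‖) (hA : 0 ≤ A) (ha : 0 < a)
    {x z y x₁ z₁ : E} (hy : y = (A / (A + a)) • x + (a / (A + a)) • z)
    (hx₁ : x₁ = (A / (A + a)) • x + (a / (A + a)) • z₁) :
    (A + a) * φ x₁ ≤ A * φ x + a * (φ y + ⟪φ' y, z₁ - y⟫) +
      L / 2 * (a ^ 2 / (A + a)) * ‖z₁ - z‖ ^ 2 := by
  have hs : 0 < A + a := by positivity
  have hstep : x₁ - y = (a / (A + a)) • (z₁ - z) := by rw [hy, hx₁]; module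
  have hsplit : (A + a) * ⟪φ' y, x₁ - y⟫ = A * ⟪φ' y, x - y⟫ + a * ⟪φ' y, z₁ - y⟫ := by
    have : (A + a) • (x₁ - y) = A • (x - y) + a • (z₁ - y) := by
      have : (A + a) • x₁ = A • x + a • z₁ := by
        rw [hx₁, smul_add, smul_smul, smul_smul, mul_div_cancel₀ _ hs.ne',
          mul_div_cancel₀ _ hs.ne']
      rw [smul_sub, this]; module
    simpa [inner_add_right, real_inner_smul_right] using congrArg (fun w => ⟪φ' y, w⟫) this
  have h1 := le_add_inner_gradient_add_sq hφ hLip y x₁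
  have h2 := hconv.add_inner_gradient_le hφ y x
  have hnorm : (A + a) * ‖x₁ - y‖ ^ 2 = a ^ 2 / (A + a) * ‖z₁ - z‖ ^ 2 := by
    rw [hstep, norm_smul, Real.norm_of_nonneg (by positivity)]
    field_simp
  linear_combination (A + a) * h1 + A * h2 + hsplit + L / 2 * hnorm

end

theorem inner_sub_le_zero_of_forall_norm_sub_le {E : Type*} [NormedAddCommGroup E]
    [InnerProductSpace ℝ E] {K : Set E} (hK : Convex ℝ K) {p u w : E} (hp : p ∈ K) (hw : w ∈ K)
    (hmin : ∀ v ∈ K, ‖p - u‖ ≤ ‖v - u‖) : ⟪u - p, w - p⟫ ≤ 0 := by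
  have : Nonempty K := ⟨⟨p, hp⟩⟩
  refine (norm_eq_iInf_iff_real_inner_le_zero hK hp).1 (le_antisymm ?_ ?_) w hw
  · exact le_ciInf fun v => by simpa only [norm_sub_rev u] using hmin v v.2
  · exact ciInf_le ⟨0, by rintro _ ⟨v, rfl⟩; exact norm_nonneg _⟩ (⟨p, hp⟩ : K)

theorem agm_bio_weighted_sum
    {n : ℕ} {f g : EuclideanSpace ℝ (Fin n) → ℝ}
    {f' g' : EuclideanSpace ℝ (Fin n) → EuclideanSpace ℝ (Fin n)}
    {Z : Set (EuclideanSpace ℝ (Fin n))}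
    {L_f L_g : ℝ} (hLf : 0 < L_f) (hLg : 0 < L_g)
    (hZconv : Convex ℝ Z) (hZcl : IsClosed Z)
    (hfconv : ConvexOn ℝ Set.univ f) (hgconv : ConvexOn ℝ Set.univ g)
    (hf' : ∀ w, HasGradientAt f (f' w) w)
    (hg' : ∀ w, HasGradientAt g (g' w) w)
    (hLipf : ∀ u v, ‖f' u - f' v‖ ≤ L_f * ‖u - v‖)
    (hLipg : ∀ u v, ‖g' u - g' v‖ ≤ L_g * ‖u - v‖)
    {xstar : EuclideanSpace ℝ (Fin n)}
    (hxZ : xstar ∈ Z)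
    (hxlow : ∀ w ∈ Z, g xstar ≤ g w)
    (hxopt : ∀ w ∈ Z, (∀ u ∈ Z, g w ≤ g u) → f xstar ≤ f w)
    {γ : ℝ} (hγ0 : 0 < γ) (hγ1 : γ ≤ 1)
    {x z y : ℕ → EuclideanSpace ℝ (Fin n)} {A a gs : ℕ → ℝ}
    (hA0 : A 0 = 0) (hxz0 : x 0 = z 0)
    (ha : ∀ k : ℕ, a k = γ * ((k : ℝ) + 1) / (4 * L_f))
    (hArec : ∀ k, A (k + 1) = A k + a k)
    (hy : ∀ k, y k = (A k / (A k + a k)) • x k + (a k / (A k + a k)) • z k)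
    (hgs : ∀ k : ℕ, 0 ≤ gs k - g xstar ∧
        gs k - g xstar ≤ 2 * L_g * ‖x 0 - xstar‖ ^ 2 / ((k : ℝ) + 1) ^ 2)
    (hzmem : ∀ k, z (k + 1) ∈ Z ∧ g (y k) + ⟪g' (y k), z (k + 1) - y k⟫ ≤ gs k)
    (hzproj : ∀ k, ∀ w ∈ Z, g (y k) + ⟪g' (y k), w - y k⟫ ≤ gs k →
        ‖z (k + 1) - (z k - a k • f' (y k))‖ ≤ ‖w - (z k - a k • f' (y k))‖)
    (hxrec : ∀ k, x (k + 1) = (A k / (A k + a k)) • x k + (a k / (A k + a k)) • z (k + 1)) :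
    ∀ lam : ℝ, L_g / ((2 / γ - 1) * L_f) ≤ lam → ∀ k : ℕ, 1 ≤ k →
      lam * (f (x k) - f xstar) + g (x k) - g xstar ≤
        4 * L_g * ‖x 0 - xstar‖ ^ 2 * (Real.log (k : ℝ) + 1) / ((k : ℝ) * ((k : ℝ) + 1)) +
          4 * lam * L_f * ‖x 0 - xstar‖ ^ 2 / (γ * (k : ℝ) * ((k : ℝ) + 1)) := by
  intro lam hlam k hk
  have hγ2 : 0 < 2 / γ - 1 := by
    rw [sub_pos, lt_div_iff₀ hγ0]; linarith
  have hlam0 : 0 ≤ lam := le_trans (by positivity) hlam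
  have hapos (i : ℕ) : 0 < a i := by rw [ha]; positivity
  have hAval (i : ℕ) : A i = γ * (i * (i + 1)) / (8 * L_f) := by
    induction i with
    | zero => simp [hA0]
    | succ i ih => rw [hArec, ih, ha]; push_cast; field_simp; ring
  have hAnonneg (i : ℕ) : 0 ≤ A i := by rw [hAval]; positivity
  set R := ‖x 0 - xstar‖ with hR
  have hcoef (i : ℕ) : (lam * L_f + L_g) * (a i ^ 2 / (A i + a i)) ≤ lam := by
    have hratio : a i ^ 2 / (A i + a i) ≤ γ / (2 * L_f) := by
      rw [← hArec, hAval, ha, div_le_div_iff₀ (by push_cast; positivity) (by positivity)]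
      push_cast
      field_simp
      linarith
    have hLg_le : L_g ≤ lam * ((2 / γ - 1) * L_f) := (div_le_iff₀ (by positivity)).1 hlam
    have hratio0 : 0 ≤ a i ^ 2 / (A i + a i) :=
      div_nonneg (sq_nonneg _) (add_nonneg (hAnonneg i) (hapos i).le)
    calc (lam * L_f + L_g) * (a i ^ 2 / (A i + a i))
        ≤ (lam * L_f + lam * ((2 / γ - 1) * L_f)) * (γ / (2 * L_f)) := by gcongr
      _ = lam := by field_simp; ring
  have hsteps (i : ℕ) :
      A (i + 1) * (lam * (f (x (i + 1)) - f xstar) + (g (x (i + 1)) - g xstar)) +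
          lam / 2 * ‖z (i + 1) - xstar‖ ^ 2 ≤
        A i * (lam * (f (x i) - f xstar) + (g (x i) - g xstar)) +
          lam / 2 * ‖z i - xstar‖ ^ 2 + a i * (gs i - g xstar) := by
    have hfstep := hfconv.accelerated_step_le hf' hLipf (hAnonneg i) (hapos i) (hy i) (hxrec i)
    have hgstep := hgconv.accelerated_step_le hg' hLipg (hAnonneg i) (hapos i) (hy i) (hxrec i)
    have hfstar := hfconv.add_inner_gradient_le hf' (y i) xstar
    have hgstar := hgconv.add_inner_gradient_le hg' (y i) xstar
    have hK : Convex ℝ (Z ∩ {w | g (y i) + ⟪g' (y i), w - y i⟫ ≤ gs i}) := by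
      refine hZconv.inter fun u hu v hv s t hs ht hst => ?_
      simp only [Set.mem_ofPred_eq] at hu hv ⊢
      have hcomb : s • u + t • v - y i = s • (u - y i) + t • (v - y i) := by
        have : y i = (s + t) • y i := by rw [hst, one_smul]
        rw [smul_sub, smul_sub, sub_add_sub_comm, ← add_smul, ← this]
      rw [hcomb, inner_add_right, real_inner_smul_right, real_inner_smul_right]
      have hs' : s = 1 - t := by linarith
      subst hs'
      nlinarith [mul_le_mul_of_nonneg_left hu hs, mul_le_mul_of_nonneg_left hv ht]
    have hproj := inner_sub_le_zero_of_forall_norm_sub_le hK (hzmem i)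
      ⟨hxZ, hgstar.trans (sub_nonneg.1 (hgs i).1)⟩ fun w hw => hzproj i w hw.1 hw.2
    have hthree : a i * ⟪f' (y i), z (i + 1) - xstar⟫ ≤
        1 / 2 * (‖z i - xstar‖ ^ 2 - ‖z (i + 1) - xstar‖ ^ 2 - ‖z (i + 1) - z i‖ ^ 2) := by
      have hsum : z i - xstar = (z (i + 1) - xstar) - (z (i + 1) - z i) := by abel
      have hexp := norm_sub_sq_real (z (i + 1) - xstar) (z (i + 1) - z i)
      rw [← hsum] at hexp
      have hin : ⟪z i - a i • f' (y i) - z (i + 1), xstar - z (i + 1)⟫ =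
          ⟪z (i + 1) - xstar, z (i + 1) - z i⟫ + a i * ⟪f' (y i), z (i + 1) - xstar⟫ := by
        have h1 : z i - a i • f' (y i) - z (i + 1) =
          -((z (i + 1) - z i) + a i • f' (y i)) := by abel
        have h2 : xstar - z (i + 1) = -(z (i + 1) - xstar) := by abel
        rw [h1, h2, inner_neg_neg, inner_add_left, real_inner_smul_left,
          real_inner_comm (z (i + 1) - xstar)]
      linarith
    have hsplit : ⟪f' (y i), z (i + 1) - y i⟫ =
        ⟪f' (y i), xstar - y i⟫ + ⟪f' (y i), z (i + 1) - xstar⟫ := by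
      rw [← inner_add_right]; congr 1; abel
    rw [hsplit] at hfstep
    rw [hArec]
    have hai := (hapos i).le
    have hf_total : (A i + a i) * (f (x (i + 1)) - f xstar) ≤ A i * (f (x i) - f xstar) +
        1 / 2 * (‖z i - xstar‖ ^ 2 - ‖z (i + 1) - xstar‖ ^ 2 - ‖z (i + 1) - z i‖ ^ 2) +
        L_f / 2 * (a i ^ 2 / (A i + a i)) * ‖z (i + 1) - z i‖ ^ 2 := by
      linear_combination hfstep + hthree + a i * hfstar
    linear_combination lam * hf_total + hgstep + a i * (hzmem i).2 +
      1 / 2 * ‖z (i + 1) - z i‖ ^ 2 * hcoef i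
  have hsum (i : ℕ) :
      A i * (lam * (f (x i) - f xstar) + (g (x i) - g xstar)) + lam / 2 * ‖z i - xstar‖ ^ 2 ≤
        lam / 2 * R ^ 2 + γ * L_g * R ^ 2 / (2 * L_f) * (harmonic i : ℝ) := by
    induction i with
    | zero => simp [hA0, hR, hxz0]
    | succ i ih =>
      have herr : a i * (gs i - g xstar) ≤ γ * L_g * R ^ 2 / (2 * L_f) * ((i : ℝ) + 1)⁻¹ := by
        calc a i * (gs i - g xstar) ≤ a i * (2 * L_g * R ^ 2 / ((i : ℝ) + 1) ^ 2) :=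
              mul_le_mul_of_nonneg_left (hgs i).2 (hapos i).le
          _ = _ := by rw [ha]; field_simp; ring
      rw [harmonic_succ]
      push_cast
      linarith [hsteps i]
  have hk0 : (0 : ℝ) < k := by exact_mod_cast hk
  have hAk : 0 < A k := by rw [hAval]; positivity
  have hbound : A k * (lam * (f (x k) - f xstar) + (g (x k) - g xstar)) ≤
      lam / 2 * R ^ 2 + γ * L_g * R ^ 2 / (2 * L_f) * (Real.log k + 1) := by
    have hH : (harmonic k : ℝ) ≤ Real.log k + 1 := by linarith [harmonic_le_one_add_log k]
    have hC : 0 ≤ γ * L_g * R ^ 2 / (2 * L_f) := by positivity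
    have hz : 0 ≤ lam / 2 * ‖z k - xstar‖ ^ 2 := by positivity
    linarith [hsum k, mul_le_mul_of_nonneg_left hH hC]
  rw [add_sub_assoc]
  refine le_of_mul_le_mul_left (hbound.trans_eq ?_) hAk
  rw [hAval]
  field_simp
  ring
end

section
/- Suppose g satisfies the r-th order Hölderian error bound with r > 1. Run the AGM-BiO iteration for T iterations with step sizes a_k = γ(k+1)/(4 L_f) where γ = 1/( (2 L_g / L_f) T^{(2r−2)/(2r−1)} + 2 ). Then the output x_T satisfies f(x_T) − f(x*) ≤ C_g (ln T + 1) / T^{2r/(2r−1)} + C_f / T², where C_f = 8 L_f ‖x_0 − x*‖² and C_g = 12 L_g ‖x_0 − x*‖². -/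
open RealInnerProductSpace

/-- First-order characterization of convexity in terms of the gradient. -/
lemma ConvexOn.add_inner_gradient_le_s4 {E : Type*} [NormedAddCommGroup E] [InnerProductSpace ℝ E]
    [CompleteSpace E] {f : E → ℝ} {u d : E} (hf : ConvexOn ℝ Set.univ f)
    (hd : HasGradientAt f d u) (v : E) : f u + ⟪d, v - u⟫ ≤ f v := by
  have hline : ConvexOn ℝ Set.univ (f ∘ AffineMap.lineMap (k := ℝ) u v) := by
    simpa using hf.comp_affineMap (AffineMap.lineMap (k := ℝ) u v)
  have hderiv : HasDerivAt (f ∘ AffineMap.lineMap (k := ℝ) u v) ⟪d, v - u⟫ 0 := by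
    have h1 : HasFDerivAt f (InnerProductSpace.toDual ℝ E d) (AffineMap.lineMap (k := ℝ) u v 0) := by
      simpa using hd.hasFDerivAt
    simpa using h1.comp_hasDerivAt (0 : ℝ) AffineMap.hasDerivAt_lineMap
  have := hline.le_slope_of_hasDerivAt (Set.mem_univ 0) (Set.mem_univ 1) one_pos hderiv
  simp [slope_def_field] at this
  linarith

/-- A weak form of the descent lemma for convex functions with Lipschitz gradient. -/
lemma ConvexOn.le_add_inner_gradient_add_sq {E : Type*} [NormedAddCommGroup E]
    [InnerProductSpace ℝ E] [CompleteSpace E] {f : E → ℝ} {f' : E → E} {L : ℝ}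
    (hf : ConvexOn ℝ Set.univ f) (hf' : ∀ w, HasGradientAt f (f' w) w)
    (hL : ∀ u v, ‖f' u - f' v‖ ≤ L * ‖u - v‖) (u v : E) :
    f v ≤ f u + ⟪f' u, v - u⟫ + L * ‖v - u‖ ^ 2 := by
  have h1 := hf.add_inner_gradient_le_s4 (hf' v) u
  have h2 : ⟪f' v - f' u, v - u⟫ ≤ L * ‖v - u‖ ^ 2 := by
    calc ⟪f' v - f' u, v - u⟫ ≤ ‖f' v - f' u‖ * ‖v - u‖ := real_inner_le_norm _ _
      _ ≤ L * ‖v - u‖ * ‖v - u‖ := by gcongr; exact hL v u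
      _ = L * ‖v - u‖ ^ 2 := by ring
  have h3 : ⟪f' v, u - v⟫ = -⟪f' v, v - u⟫ := by rw [← inner_neg_right, neg_sub]
  rw [inner_sub_left] at h2
  linarith

/-- The variational inequality satisfied by a nearest point of a convex set. -/
lemma Convex.inner_sub_le_zero_of_forall_norm_le {E : Type*} [NormedAddCommGroup E]
    [InnerProductSpace ℝ E] {K : Set E} (hK : Convex ℝ K) {u v : E} (hv : v ∈ K)
    (hmin : ∀ w ∈ K, ‖v - u‖ ≤ ‖w - u‖) {w : E} (hw : w ∈ K) : ⟪u - v, w - v⟫ ≤ 0 := by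
  refine (norm_eq_iInf_iff_real_inner_le_zero hK hv).1 ?_ w hw
  have : Nonempty K := ⟨⟨v, hv⟩⟩
  refine le_antisymm (le_ciInf fun w => ?_)
    (ciInf_le ⟨0, by rintro _ ⟨w, rfl⟩; exact norm_nonneg _⟩ (⟨v, hv⟩ : K))
  rw [norm_sub_rev u v, norm_sub_rev u w]
  exact hmin w w.2

/-- One step of the accelerated projected gradient method decreases the potential
`A * (f x - f p) + ‖z - p‖ ^ 2 / 2`. -/
lemma accelerated_gradient_potential_le {E : Type*} [NormedAddCommGroup E]
    [InnerProductSpace ℝ E] [CompleteSpace E] {f : E → ℝ} {f' : E → E} {L A a : ℝ}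
    (hf : ConvexOn ℝ Set.univ f) (hf' : ∀ w, HasGradientAt f (f' w) w)
    (hL : ∀ u v, ‖f' u - f' v‖ ≤ L * ‖u - v‖) (hA : 0 ≤ A) (ha : 0 < a)
    (hstep : 2 * L * a ^ 2 ≤ A + a) {x y z x₁ z₁ p : E}
    (hy : y = (A / (A + a)) • x + (a / (A + a)) • z)
    (hx₁ : x₁ = (A / (A + a)) • x + (a / (A + a)) • z₁)
    (hproj : ⟪z - a • f' y - z₁, p - z₁⟫ ≤ 0) :
    (A + a) * (f x₁ - f p) + ‖z₁ - p‖ ^ 2 / 2 ≤ A * (f x - f p) + ‖z - p‖ ^ 2 / 2 := by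
  have hpos : 0 < A + a := by positivity
  have hx₁y : x₁ - y = (a / (A + a)) • (z₁ - z) := by
    rw [hx₁, hy]; module
  have hcomb : (A + a) • (x₁ - y) = A • (x - y) + a • (z₁ - y) := by
    have : (A + a) • x₁ = A • x + a • z₁ := by
      rw [hx₁, smul_add, smul_smul, smul_smul, mul_div_cancel₀ _ hpos.ne',
        mul_div_cancel₀ _ hpos.ne']
    rw [smul_sub, this]; module
  have hdesc := hf.le_add_inner_gradient_add_sq hf' hL y x₁
  have hlow := hf.add_inner_gradient_le_s4 (hf' y) x
  have hlowp := hf.add_inner_gradient_le_s4 (hf' y) p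
  have hinner := congrArg (fun w => ⟪f' y, w⟫) hcomb
  simp only [inner_add_right, inner_smul_right] at hinner
  have hsq : (A + a) * (L * ‖x₁ - y‖ ^ 2) ≤ ‖z₁ - z‖ ^ 2 / 2 := by
    rw [hx₁y, norm_smul, mul_pow, Real.norm_eq_abs, sq_abs]
    have : (A + a) * (L * ((a / (A + a)) ^ 2 * ‖z₁ - z‖ ^ 2)) =
        L * a ^ 2 / (A + a) * ‖z₁ - z‖ ^ 2 := by field_simp
    rw [this]
    have : L * a ^ 2 / (A + a) ≤ 1 / 2 := by
      rw [div_le_iff₀ hpos]; linarith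
    nlinarith [sq_nonneg ‖z₁ - z‖]
  have hthree : ‖z - p‖ ^ 2 = ‖z₁ - z‖ ^ 2 + ‖z₁ - p‖ ^ 2 - 2 * ⟪z - z₁, p - z₁⟫ := by
    have : z - p = (z - z₁) - (p - z₁) := by abel
    rw [this, norm_sub_sq_real, norm_sub_rev z z₁, norm_sub_rev p z₁]; ring
  have hvar : ⟪z - z₁, p - z₁⟫ + a * (⟪f' y, z₁ - y⟫ - ⟪f' y, p - y⟫) ≤ 0 := by
    have h1 : z - a • f' y - z₁ = (z - z₁) - a • f' y := by abel
    have h2 : ⟪f' y, p - z₁⟫ = ⟪f' y, p - y⟫ - ⟪f' y, z₁ - y⟫ := by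
      rw [← inner_sub_right]; congr 1; abel
    rw [h1, inner_sub_left, real_inner_smul_left, h2] at hproj
    linarith
  have e1 := mul_le_mul_of_nonneg_left hdesc hpos.le
  have e2 := mul_le_mul_of_nonneg_left hlow hA
  have e3 := mul_le_mul_of_nonneg_left hlowp ha.le
  linarith

theorem agm_bio_heb_upper_bound
    {n : ℕ} {f g : EuclideanSpace ℝ (Fin n) → ℝ}
    {f' g' : EuclideanSpace ℝ (Fin n) → EuclideanSpace ℝ (Fin n)}
    {Z : Set (EuclideanSpace ℝ (Fin n))}
    {L_f L_g : ℝ} (hLf : 0 < L_f) (hLg : 0 < L_g)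
    (hZconv : Convex ℝ Z) (hZcl : IsClosed Z)
    (hfconv : ConvexOn ℝ Set.univ f) (hgconv : ConvexOn ℝ Set.univ g)
    (hf' : ∀ w, HasGradientAt f (f' w) w)
    (hg' : ∀ w, HasGradientAt g (g' w) w)
    (hLipf : ∀ u v, ‖f' u - f' v‖ ≤ L_f * ‖u - v‖)
    (hLipg : ∀ u v, ‖g' u - g' v‖ ≤ L_g * ‖u - v‖)
    {xstar : EuclideanSpace ℝ (Fin n)}
    (hxZ : xstar ∈ Z)
    (hxlow : ∀ w ∈ Z, g xstar ≤ g w)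
    (hxopt : ∀ w ∈ Z, (∀ u ∈ Z, g w ≤ g u) → f xstar ≤ f w)
    {α r : ℝ} (hα : 0 < α) (hr : 1 < r)
    (hHEB : ∀ w ∈ Z, α / r * Metric.infDist w {w ∈ Z | ∀ u ∈ Z, g w ≤ g u} ^ r ≤ g w - g xstar)
    {T : ℕ} (hT : 1 ≤ T) {γ : ℝ}
    (hγ : γ = 1 / (2 * L_g / L_f * (T : ℝ) ^ ((2 * r - 2) / (2 * r - 1)) + 2))
    {x z y : ℕ → EuclideanSpace ℝ (Fin n)} {A a gs : ℕ → ℝ}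
    (hA0 : A 0 = 0) (hxz0 : x 0 = z 0)
    (ha : ∀ k : ℕ, a k = γ * ((k : ℝ) + 1) / (4 * L_f))
    (hArec : ∀ k, A (k + 1) = A k + a k)
    (hy : ∀ k, y k = (A k / (A k + a k)) • x k + (a k / (A k + a k)) • z k)
    (hgs : ∀ k : ℕ, 0 ≤ gs k - g xstar ∧
        gs k - g xstar ≤ 2 * L_g * ‖x 0 - xstar‖ ^ 2 / ((k : ℝ) + 1) ^ 2)
    (hzmem : ∀ k, z (k + 1) ∈ Z ∧ g (y k) + ⟪g' (y k), z (k + 1) - y k⟫ ≤ gs k)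
    (hzproj : ∀ k, ∀ w ∈ Z, g (y k) + ⟪g' (y k), w - y k⟫ ≤ gs k →
        ‖z (k + 1) - (z k - a k • f' (y k))‖ ≤ ‖w - (z k - a k • f' (y k))‖)
    (hxrec : ∀ k, x (k + 1) = (A k / (A k + a k)) • x k + (a k / (A k + a k)) • z (k + 1)) :
    f (x T) - f xstar ≤
      12 * L_g * ‖x 0 - xstar‖ ^ 2 * (Real.log (T : ℝ) + 1) / (T : ℝ) ^ (2 * r / (2 * r - 1)) +
        8 * L_f * ‖x 0 - xstar‖ ^ 2 / (T : ℝ) ^ 2 := by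
  have hTpos : (0 : ℝ) < T := by exact_mod_cast hT
  have hden : 2 ≤ 2 * L_g / L_f * (T : ℝ) ^ ((2 * r - 2) / (2 * r - 1)) + 2 := by
    have : 0 ≤ 2 * L_g / L_f * (T : ℝ) ^ ((2 * r - 2) / (2 * r - 1)) := by positivity
    linarith
  have hγpos : 0 < γ := by rw [hγ]; positivity
  have hγle : γ ≤ 1 / 2 := by
    rw [hγ]; exact one_div_le_one_div_of_le two_pos hden
  have hA : ∀ k : ℕ, A k = γ * (k * (k + 1)) / (8 * L_f) := by
    intro k
    induction k with
    | zero => simp [hA0]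
    | succ k ih => rw [hArec, ih, ha]; push_cast; field_simp; ring
  have hstep : ∀ k : ℕ, 2 * L_f * a k ^ 2 ≤ A k + a k := by
    intro k
    have h1 : A k + a k - 2 * L_f * a k ^ 2 =
        γ * (k + 1) * (k + 2 - γ * (k + 1)) / (8 * L_f) := by
      rw [hA, ha]; field_simp; ring
    have h2 : 0 ≤ (k : ℝ) + 2 - γ * (k + 1) := by
      nlinarith [(Nat.cast_nonneg k : (0 : ℝ) ≤ k)]
    have h3 : 0 ≤ γ * (k + 1) * (k + 2 - γ * (k + 1)) / (8 * L_f) := by positivity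
    linarith
  have hpot : ∀ k, A k * (f (x k) - f xstar) + ‖z k - xstar‖ ^ 2 / 2 ≤
      ‖x 0 - xstar‖ ^ 2 / 2 := by
    intro k
    induction k with
    | zero => simp [hA0, hxz0]
    | succ k ih =>
      have hK : Convex ℝ {w | w ∈ Z ∧ g (y k) + ⟪g' (y k), w - y k⟫ ≤ gs k} := by
        rintro u ⟨huZ, hu⟩ v ⟨hvZ, hv⟩ s t hs ht hst
        refine ⟨hZconv huZ hvZ hs ht hst, ?_⟩
        have : s • u + t • v - y k = s • (u - y k) + t • (v - y k) := by
          obtain rfl : t = 1 - s := by linarith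
          module
        rw [this, inner_add_right, real_inner_smul_right, real_inner_smul_right]
        have e : s * gs k + t * gs k = gs k := by rw [← add_mul, hst, one_mul]
        have e' : s * g (y k) + t * g (y k) = g (y k) := by rw [← add_mul, hst, one_mul]
        nlinarith [mul_le_mul_of_nonneg_left hu hs, mul_le_mul_of_nonneg_left hv ht]
      have hmem : xstar ∈ {w | w ∈ Z ∧ g (y k) + ⟪g' (y k), w - y k⟫ ≤ gs k} :=
        ⟨hxZ, (hgconv.add_inner_gradient_le_s4 (hg' (y k)) xstar).trans
          (sub_nonneg.1 (hgs k).1)⟩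
      have hproj := hK.inner_sub_le_zero_of_forall_norm_le (hzmem k)
        (fun w hw => hzproj k w hw.1 hw.2) hmem
      have hAk : 0 ≤ A k := by rw [hA]; positivity
      have hak : 0 < a k := by rw [ha]; positivity
      rw [hArec]
      exact (accelerated_gradient_potential_le hfconv hf' hLipf hAk hak (hstep k) (hy k)
        (hxrec k) hproj).trans ih
  have hmain : f (x T) - f xstar ≤ 4 * L_f * ‖x 0 - xstar‖ ^ 2 / γ / (T : ℝ) ^ 2 := by
    have h1 : A T * (f (x T) - f xstar) ≤ ‖x 0 - xstar‖ ^ 2 / 2 := by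
      linarith [hpot T, sq_nonneg ‖z T - xstar‖]
    have hAT : 0 < A T := by rw [hA]; positivity
    calc f (x T) - f xstar ≤ ‖x 0 - xstar‖ ^ 2 / 2 / A T := by
          rw [le_div_iff₀ hAT]; linarith
      _ ≤ ‖x 0 - xstar‖ ^ 2 / 2 / (γ * T ^ 2 / (8 * L_f)) := by
          rw [hA]; gcongr; nlinarith
      _ = 4 * L_f * ‖x 0 - xstar‖ ^ 2 / γ / (T : ℝ) ^ 2 := by field_simp; ring
  have hpow : (T : ℝ) ^ ((2 * r - 2) / (2 * r - 1)) / (T : ℝ) ^ 2 =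
      1 / (T : ℝ) ^ (2 * r / (2 * r - 1)) := by
    have hr1 : 2 * r - 1 ≠ 0 := by linarith
    rw [← Real.rpow_natCast, ← Real.rpow_sub hTpos, one_div, ← Real.rpow_neg hTpos.le]
    congr 1
    push_cast
    field_simp
    ring
  have hlog : 0 ≤ Real.log T := Real.log_natCast_nonneg T
  calc f (x T) - f xstar ≤ 4 * L_f * ‖x 0 - xstar‖ ^ 2 / γ / (T : ℝ) ^ 2 := hmain
    _ = 8 * L_g * ‖x 0 - xstar‖ ^ 2 *
          ((T : ℝ) ^ ((2 * r - 2) / (2 * r - 1)) / (T : ℝ) ^ 2) +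
        8 * L_f * ‖x 0 - xstar‖ ^ 2 / (T : ℝ) ^ 2 := by
      rw [hγ]; field_simp; ring
    _ = 8 * L_g * ‖x 0 - xstar‖ ^ 2 / (T : ℝ) ^ (2 * r / (2 * r - 1)) +
        8 * L_f * ‖x 0 - xstar‖ ^ 2 / (T : ℝ) ^ 2 := by
      rw [hpow, mul_one_div]
    _ ≤ _ := by
      have hR : 0 ≤ L_g * ‖x 0 - xstar‖ ^ 2 := by positivity
      have hnum : 8 * L_g * ‖x 0 - xstar‖ ^ 2 ≤
          12 * L_g * ‖x 0 - xstar‖ ^ 2 * (Real.log T + 1) := by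
        linarith [mul_nonneg hR hlog]
      gcongr
end

section
/- Under the AGM-BiO iteration with arbitrary positive step sizes a_k > 0, for every k ≥ 0 it holds that A_{k+1}(f(x_{k+1}) − f(x*)) + ½‖z_{k+1} − x*‖² − ( A_k(f(x_k) − f(x*)) + ½‖z_k − x*‖² ) ≤ ( L_f a_k² / (2 A_{k+1}) − ½ ) ‖z_{k+1} − z_k‖². -/
open RealInnerProductSpace

section FirstOrder

variable {E : Type*} [NormedAddCommGroup E] [InnerProductSpace ℝ E]

theorem HasGradientAt.hasDerivAt_comp_line [CompleteSpace E] {f : E → ℝ} {f' : E → E}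
    (hf : ∀ w, HasGradientAt f (f' w) w) (y v : E) (t : ℝ) :
    HasDerivAt (fun s : ℝ => f (y + s • v)) ⟪f' (y + t • v), v⟫ t := by
  have hline : HasDerivAt (fun s : ℝ => y + s • v) v t := by
    simpa using ((hasDerivAt_id t).smul_const v).const_add y
  exact ((hf (y + t • v)).hasFDerivAt.comp_hasDerivAt t hline).congr_deriv (by simp)

/-- A differentiable convex function lies above its tangent planes. -/
theorem ConvexOn.add_inner_gradient_le_s11 [CompleteSpace E] {f : E → ℝ} {f' : E → E}
    (hconv : ConvexOn ℝ Set.univ f) (hf : ∀ w, HasGradientAt f (f' w) w) (y w : E) :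
    f y + ⟪f' y, w - y⟫ ≤ f w := by
  have hline : ConvexOn ℝ Set.univ (fun s : ℝ => f (y + s • (w - y))) := by
    have h := hconv.comp_affineMap (AffineMap.lineMap (k := ℝ) y w)
    simpa [Function.comp_def, AffineMap.lineMap_apply, add_comm] using h
  have h := hline.le_slope_of_hasDerivAt (Set.mem_univ 0) (Set.mem_univ 1) one_pos
    (HasGradientAt.hasDerivAt_comp_line hf y (w - y) 0)
  simp [slope_def_field] at h
  linarith

/-- The descent lemma: a function with `L`-Lipschitz gradient lies below its quadratic models. -/
theorem HasGradientAt.le_add_inner_add_sq [CompleteSpace E] {f : E → ℝ} {f' : E → E} {L : ℝ}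
    (hf : ∀ w, HasGradientAt f (f' w) w) (hLip : ∀ u v, ‖f' u - f' v‖ ≤ L * ‖u - v‖)
    (y w : E) : f w ≤ f y + ⟪f' y, w - y⟫ + L / 2 * ‖w - y‖ ^ 2 := by
  set v := w - y with hv
  have hderiv (t : ℝ) : HasDerivAt
      (fun s : ℝ => f (y + s • v) - s * ⟪f' y, v⟫ - s ^ 2 * (L / 2 * ‖v‖ ^ 2))
      (⟪f' (y + t • v), v⟫ - ⟪f' y, v⟫ - 2 * t * (L / 2 * ‖v‖ ^ 2)) t := by
    have h1 := (hasDerivAt_id t).mul_const ⟪f' y, v⟫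
    have h2 := (hasDerivAt_pow 2 t).mul_const (L / 2 * ‖v‖ ^ 2)
    exact (((HasGradientAt.hasDerivAt_comp_line hf y v t).sub h1).sub h2).congr_deriv (by simp)
  have hanti : AntitoneOn
      (fun s : ℝ => f (y + s • v) - s * ⟪f' y, v⟫ - s ^ 2 * (L / 2 * ‖v‖ ^ 2)) (Set.Ici 0) := by
    refine antitoneOn_of_deriv_nonpos (convex_Ici 0)
      (fun t _ => (hderiv t).continuousAt.continuousWithinAt)
      (fun t _ => (hderiv t).differentiableAt.differentiableWithinAt) fun t ht => ?_
    have ht0 : 0 < t := by simpa using ht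
    rw [(hderiv t).deriv, ← inner_sub_left]
    have hgrad : ‖f' (y + t • v) - f' y‖ ≤ L * (t * ‖v‖) := by
      simpa [norm_smul, abs_of_pos ht0] using hLip (y + t • v) y
    have hinner := (real_inner_le_norm (f' (y + t • v) - f' y) v).trans
      (mul_le_mul_of_nonneg_right hgrad (norm_nonneg v))
    linarith
  have h := hanti (Set.mem_Ici.2 le_rfl) (Set.mem_Ici.2 zero_le_one) zero_le_one
  have hw : y + v = w := by simp [hv]
  simp [hw] at h
  linarith

theorem Convex.inner_sub_nonpos_of_forall_norm_le {K : Set E} (hK : Convex ℝ K) {u p : E}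
    (hp : p ∈ K) (hmin : ∀ w ∈ K, ‖p - u‖ ≤ ‖w - u‖) {w : E} (hw : w ∈ K) :
    ⟪u - p, w - p⟫ ≤ 0 := by
  have : Nonempty K := ⟨⟨p, hp⟩⟩
  refine (norm_eq_iInf_iff_real_inner_le_zero hK hp).1 (le_antisymm ?_ ?_) w hw
  · exact le_ciInf fun w => by simpa only [norm_sub_rev u] using hmin w w.2
  · exact ciInf_le (f := fun w : K => ‖u - w‖)
      ⟨0, Set.forall_mem_range.2 fun _ => norm_nonneg _⟩ ⟨p, hp⟩

theorem convex_setOf_add_inner_sub_le (v y : E) (b c : ℝ) :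
    Convex ℝ {w | b + ⟪v, w - y⟫ ≤ c} := by
  have h : {w | b + ⟪v, w - y⟫ ≤ c} = {w | innerₛₗ ℝ v w ≤ c - b + ⟪v, y⟫} := by
    ext w
    simp only [inner_sub_right, innerₛₗ_apply_apply, Set.mem_ofPred_eq]
    constructor <;> intro h <;> linarith
  rw [h]
  exact convex_halfSpace_le (innerₛₗ ℝ v).isLinear _

end FirstOrder

theorem agm_bio_potential_f
    {n : ℕ} {f g : EuclideanSpace ℝ (Fin n) → ℝ}
    {f' g' : EuclideanSpace ℝ (Fin n) → EuclideanSpace ℝ (Fin n)}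
    {Z : Set (EuclideanSpace ℝ (Fin n))}
    {L_f L_g : ℝ} (hLf : 0 < L_f) (hLg : 0 < L_g)
    (hZconv : Convex ℝ Z) (hZcl : IsClosed Z)
    (hfconv : ConvexOn ℝ Set.univ f) (hgconv : ConvexOn ℝ Set.univ g)
    (hf' : ∀ w, HasGradientAt f (f' w) w)
    (hg' : ∀ w, HasGradientAt g (g' w) w)
    (hLipf : ∀ u v, ‖f' u - f' v‖ ≤ L_f * ‖u - v‖)
    (hLipg : ∀ u v, ‖g' u - g' v‖ ≤ L_g * ‖u - v‖)
    {xstar : EuclideanSpace ℝ (Fin n)}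
    (hxZ : xstar ∈ Z)
    (hxlow : ∀ w ∈ Z, g xstar ≤ g w)
    (hxopt : ∀ w ∈ Z, (∀ u ∈ Z, g w ≤ g u) → f xstar ≤ f w)
    {x z y : ℕ → EuclideanSpace ℝ (Fin n)} {A a gs : ℕ → ℝ}
    (hA0 : A 0 = 0) (hxz0 : x 0 = z 0)
    (ha : ∀ k, 0 < a k)
    (hArec : ∀ k, A (k + 1) = A k + a k)
    (hy : ∀ k, y k = (A k / (A k + a k)) • x k + (a k / (A k + a k)) • z k)
    (hgs : ∀ k, g xstar ≤ gs k)
    (hzmem : ∀ k, z (k + 1) ∈ Z ∧ g (y k) + ⟪g' (y k), z (k + 1) - y k⟫ ≤ gs k)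
    (hzproj : ∀ k, ∀ w ∈ Z, g (y k) + ⟪g' (y k), w - y k⟫ ≤ gs k →
        ‖z (k + 1) - (z k - a k • f' (y k))‖ ≤ ‖w - (z k - a k • f' (y k))‖)
    (hxrec : ∀ k, x (k + 1) = (A k / (A k + a k)) • x k + (a k / (A k + a k)) • z (k + 1)) :
    ∀ k : ℕ,
      A (k + 1) * (f (x (k + 1)) - f xstar) + 1 / 2 * ‖z (k + 1) - xstar‖ ^ 2 -
          (A k * (f (x k) - f xstar) + 1 / 2 * ‖z k - xstar‖ ^ 2) ≤
        (L_f * a k ^ 2 / (2 * A (k + 1)) - 1 / 2) * ‖z (k + 1) - z k‖ ^ 2 := by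
  intro k
  have hak := ha k
  have hAnonneg : ∀ j, 0 ≤ A j := by
    intro j
    induction j with
    | zero => exact hA0.ge
    | succ j ih => rw [hArec]; exact add_nonneg ih (ha j).le
  have hAk := hAnonneg k
  have hpos : 0 < A k + a k := by linarith
  have hproj : ⟪z k - a k • f' (y k) - z (k + 1), xstar - z (k + 1)⟫ ≤ 0 := by
    have hhalf : Convex ℝ {w | g (y k) + ⟪g' (y k), w - y k⟫ ≤ gs k} :=
      convex_setOf_add_inner_sub_le _ _ _ _
    exact (hZconv.inter hhalf).inner_sub_nonpos_of_forall_norm_le (hzmem k)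
      (fun w hw => hzproj k w hw.1 hw.2)
      ⟨hxZ, (hgconv.add_inner_gradient_le_s11 hg' (y k) xstar).trans (hgs k)⟩
  have hstep : x (k + 1) - y k = (a k / (A k + a k)) • (z (k + 1) - z k) := by
    rw [hxrec, hy]; module
  have hbalance : (A k + a k) • (x (k + 1) - y k) =
      A k • (x k - y k) + a k • (xstar - y k) + a k • (z (k + 1) - xstar) := by
    have h : (A k + a k) • x (k + 1) = A k • x k + a k • z (k + 1) := by
      rw [hxrec, smul_add, smul_smul, smul_smul, mul_div_cancel₀ _ hpos.ne',
        mul_div_cancel₀ _ hpos.ne']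
    rw [smul_sub, h]; module
  have hbalance' := congrArg (fun v => ⟪f' (y k), v⟫) hbalance
  simp only [inner_add_right, real_inner_smul_right] at hbalance'
  have hdescent := mul_le_mul_of_nonneg_left
    (HasGradientAt.le_add_inner_add_sq hf' hLipf (y k) (x (k + 1))) hpos.le
  have hquad : (A k + a k) * (L_f / 2 * ‖x (k + 1) - y k‖ ^ 2) =
      L_f * a k ^ 2 / (2 * (A k + a k)) * ‖z (k + 1) - z k‖ ^ 2 := by
    rw [hstep, norm_smul, mul_pow, Real.norm_eq_abs, sq_abs]
    field_simp
  have hx := mul_le_mul_of_nonneg_left (hfconv.add_inner_gradient_le_s11 hf' (y k) (x k)) hAk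
  have hstar := mul_le_mul_of_nonneg_left (hfconv.add_inner_gradient_le_s11 hf' (y k) xstar) hak.le
  have hthree : ⟪z k - a k • f' (y k) - z (k + 1), xstar - z (k + 1)⟫ =
      a k * ⟪f' (y k), z (k + 1) - xstar⟫ + 1 / 2 * (‖z (k + 1) - xstar‖ ^ 2
        + ‖z (k + 1) - z k‖ ^ 2 - ‖z k - xstar‖ ^ 2) := by
    simp only [← real_inner_self_eq_norm_sq, inner_sub_left, inner_sub_right,
      real_inner_smul_left]
    rw [real_inner_comm xstar (z (k + 1)), real_inner_comm xstar (z k),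
      real_inner_comm (z k) (z (k + 1))]
    ring
  rw [hArec]
  linarith
end
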